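/- For fixed probability distributions q and r on a finite set with full support, and α ∈ (0,1), the functional S(p) = α·KL(p‖q) + (1−α)·KL(p‖r), defined on probability distributions p of full support, attains its unique minimum at p*(k) = r(k)^(1−α)·q(k)^α / Z, where Z = Σ_j r(j)^(1−α)·q(j)^α. -/

import Mathlib

open Finset Real Filter

noncomputable def KL {m : ℕ} (p q : Fin m → ℝ) : ℝ := ∑ k, p k * Real.log (p k / q k)

def IsDist {m : ℕ} (p : Fin m → ℝ) : Prop := (∀ k, 0 < p k) ∧ ∑ k, p k = 1

/-- Gibbs' inequality, strict form. -/
theorem KL_pos {m : ℕ} {p q : Fin m → ℝ} (hp : IsDist p) (hq : IsDist q) (hne : p ≠ q) :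
    0 < KL p q := by
  have key (k : Fin m) (h : p k ≠ q k) : p k - q k < p k * Real.log (p k / q k) := by
    have h1 := Real.log_lt_sub_one_of_pos (div_pos (hq.1 k) (hp.1 k))
      (fun e => h ((div_eq_one_iff_eq (hp.1 k).ne').1 e).symm)
    have h2 := mul_lt_mul_of_pos_left h1 (hp.1 k)
    rw [mul_sub, mul_div_cancel₀ _ (hp.1 k).ne', mul_one] at h2
    rw [← inv_div, Real.log_inv]
    linarith
  obtain ⟨i, hi⟩ := Function.ne_iff.1 hne
  have hsum : ∑ k, (p k - q k) < KL p q := by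
    refine Finset.sum_lt_sum (fun k _ => ?_) ⟨i, Finset.mem_univ i, key i hi⟩
    by_cases h : p k = q k
    · simp [h, (hq.1 k).ne']
    · exact (key k h).le
  rwa [Finset.sum_sub_distrib, hp.2, hq.2, sub_self] at hsum

theorem KL_self {m : ℕ} {p : Fin m → ℝ} (hp : IsDist p) : KL p p = 0 :=
  Finset.sum_eq_zero fun k _ => by simp [(hp.1 k).ne']

/-- The weighted sum of divergences to `q` and `r` is, up to a constant, the divergence to their
normalized weighted geometric mean. -/
theorem weighted_KL_eq {m : ℕ} {p q r s : Fin m → ℝ} {α Z : ℝ} (hp : IsDist p)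
    (hq : ∀ k, 0 < q k) (hr : ∀ k, 0 < r k) (hZ : 0 < Z)
    (hs : ∀ k, s k = (r k) ^ (1 - α) * (q k) ^ α / Z) :
    α * KL p q + (1 - α) * KL p r = KL p s - Real.log Z := by
  have hlog : Real.log Z = ∑ k, p k * Real.log Z := by rw [← Finset.sum_mul, hp.2, one_mul]
  rw [hlog]
  simp only [KL]
  rw [Finset.mul_sum, Finset.mul_sum, ← Finset.sum_add_distrib, ← Finset.sum_sub_distrib]
  refine Finset.sum_congr rfl fun k _ => ?_
  have h1 := Real.rpow_pos_of_pos (hr k) (1 - α)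
  have h2 := Real.rpow_pos_of_pos (hq k) α
  rw [hs, Real.log_div (hp.1 k).ne' (hq k).ne', Real.log_div (hp.1 k).ne' (hr k).ne',
    Real.log_div (hp.1 k).ne' (div_pos (mul_pos h1 h2) hZ).ne',
    Real.log_div (mul_pos h1 h2).ne' hZ.ne', Real.log_mul h1.ne' h2.ne',
    Real.log_rpow (hr k), Real.log_rpow (hq k)]
  ring

theorem stmt0 {m : ℕ} (hm : 1 ≤ m) (q r : Fin m → ℝ) (hq : IsDist q) (hr : IsDist r)
    (α : ℝ) (hα : α ∈ Set.Ioo (0:ℝ) 1)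
    (Z : ℝ) (hZ : Z = ∑ j, (r j) ^ (1 - α) * (q j) ^ α)
    (pstar : Fin m → ℝ) (hps : ∀ k, pstar k = (r k) ^ (1 - α) * (q k) ^ α / Z) :
    IsDist pstar ∧
    (∀ p : Fin m → ℝ, IsDist p →
      α * KL pstar q + (1 - α) * KL pstar r ≤ α * KL p q + (1 - α) * KL p r) ∧
    (∀ p : Fin m → ℝ, IsDist p → p ≠ pstar →
      α * KL pstar q + (1 - α) * KL pstar r < α * KL p q + (1 - α) * KL p r) := by
  have hw (k : Fin m) : 0 < (r k) ^ (1 - α) * (q k) ^ α :=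
    mul_pos (Real.rpow_pos_of_pos (hr.1 k) _) (Real.rpow_pos_of_pos (hq.1 k) _)
  have hZpos : 0 < Z := by
    rw [hZ]
    exact Finset.sum_pos (fun k _ => hw k) ⟨⟨0, hm⟩, Finset.mem_univ _⟩
  have hdist : IsDist pstar := by
    refine ⟨fun k => hps k ▸ div_pos (hw k) hZpos, ?_⟩
    simp only [hps]
    rw [← Finset.sum_div, ← hZ, div_self hZpos.ne']
  have hlt (p : Fin m → ℝ) (hp : IsDist p) (hne : p ≠ pstar) :
      α * KL pstar q + (1 - α) * KL pstar r < α * KL p q + (1 - α) * KL p r := by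
    rw [weighted_KL_eq hdist hq.1 hr.1 hZpos hps, weighted_KL_eq hp hq.1 hr.1 hZpos hps,
      KL_self hdist]
    linarith [KL_pos hp hdist hne]
  refine ⟨hdist, fun p hp => ?_, hlt⟩
  by_cases hne : p = pstar
  · rw [hne]
  · exact (hlt p hp hne).le
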